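/- Under the aggregated computational-graph setup, assume in addition that S is twice continuously differentiable, and let A = [∂_xΦ, ∂_sΦ − I]. Then the symmetric KKT matrix [[∇²_{(x,s)}L(x₀,s₀,λ₀), Aᵀ],[A, 0]] of size (n+2m)×(n+2m) is invertible if and only if the Hessian ∇²f(x₀) of the unconstrained objective is invertible. -/

import Mathlib

open Matrix

/-- The second derivative of `x ↦ L (x, S x)` at a point where `L` is stationary in its second
argument: the curvature of `S` does not contribute. -/
theorem iteratedFDeriv_two_comp_graph {E F : Type*} [NormedAddCommGroup E] [NormedSpace ℝ E]
    [NormedAddCommGroup F] [NormedSpace ℝ F] {L : E × F → ℝ} {S : E → F} {x : E}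
    (hL : ContDiff ℝ 2 L) (hS : ContDiff ℝ 2 S)
    (hstat : ∀ w : F, fderiv ℝ L (x, S x) (0, w) = 0) (u v : E) :
    iteratedFDeriv ℝ 2 (fun y => L (y, S y)) x ![u, v]
      = iteratedFDeriv ℝ 2 L (x, S x) ![(u, fderiv ℝ S x u), (v, fderiv ℝ S x v)] := by
  have hLd : Differentiable ℝ L := hL.differentiable (by norm_num)
  have hSd : Differentiable ℝ S := hS.differentiable (by norm_num)
  have hL' : Differentiable ℝ (fderiv ℝ L) :=
    (hL.fderiv_right (m := 1) (by norm_num)).differentiable (by norm_num)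
  have hS' : Differentiable ℝ (fderiv ℝ S) :=
    (hS.fderiv_right (m := 1) (by norm_num)).differentiable (by norm_num)
  have hgraph : ∀ y, HasFDerivAt (fun z => (z, S z))
      ((ContinuousLinearMap.id ℝ E).prod (fderiv ℝ S y)) y :=
    fun y => (hasFDerivAt_id y).prodMk (hSd y).hasFDerivAt
  have hfirst : ∀ v, (fun y => fderiv ℝ (fun z => L (z, S z)) y v)
      = fun y => fderiv ℝ L (y, S y) (v, fderiv ℝ S y v) := by
    intro v
    funext y
    have h : HasFDerivAt (fun z => L (z, S z)) _ y :=
      (hLd (y, S y)).hasFDerivAt.comp y (hgraph y)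
    rw [h.fderiv]
    rfl
  have hcomp : ContDiff ℝ 2 (fun z => L (z, S z)) := hL.comp (contDiff_id.prodMk hS)
  have hcomp' : Differentiable ℝ (fderiv ℝ (fun z => L (z, S z))) :=
    (hcomp.fderiv_right (m := 1) (by norm_num)).differentiable (by norm_num)
  rw [iteratedFDeriv_two_apply, iteratedFDeriv_two_apply]
  simp only [Matrix.cons_val_zero, Matrix.cons_val_one]
  have hleft := (hcomp' x).hasFDerivAt.clm_apply (hasFDerivAt_const v x)
  rw [hfirst v] at hleft
  have hright := ((hL' (x, S x)).hasFDerivAt.comp x (hgraph x)).clm_apply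
    ((hasFDerivAt_const v x).prodMk ((hS' x).hasFDerivAt.clm_apply (hasFDerivAt_const v x)))
  have key := congrArg (fun T => T u) (hleft.unique hright)
  simpa [hstat] using key

theorem isUnit_matrix_iff_forall_mulVec_eq_zero {k K : Type*} [Fintype k] [DecidableEq k] [Field K]
    (M : Matrix k k K) : IsUnit M ↔ ∀ v, M *ᵥ v = 0 → v = 0 := by
  rw [← mulVec_injective_iff_isUnit]
  exact injective_iff_map_eq_zero M.mulVecLin

/-- If `A = [-(B * J), B]` with `B` invertible, so that the columns of `Z = [1; J]` span the kernel
of `A`, then the saddle-point matrix of `H` and `A` is invertible iff `Zᵀ * H * Z` is. -/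
theorem isUnit_saddlePoint_iff {n m K : Type*} [Fintype n] [Fintype m]
    [DecidableEq n] [DecidableEq m] [Field K]
    (H : Matrix (n ⊕ m) (n ⊕ m) K) (B : Matrix m m K) (J : Matrix m n K) (hB : IsUnit B) :
    IsUnit (fromBlocks H (fromCols (-(B * J)) B)ᵀ (fromCols (-(B * J)) B) 0) ↔
      IsUnit ((fromRows 1 J : Matrix (n ⊕ m) n K)ᵀ * H * (fromRows 1 J : Matrix (n ⊕ m) n K)) := by
  have hB' := (isUnit_matrix_iff_forall_mulVec_eq_zero B).1 hB
  have hBt : IsUnit Bᵀ := (isUnit_transpose B).2 hB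
  have hBt' := (isUnit_matrix_iff_forall_mulVec_eq_zero Bᵀ).1 hBt
  rw [isUnit_matrix_iff_forall_mulVec_eq_zero, isUnit_matrix_iff_forall_mulVec_eq_zero]
  set Z : Matrix (n ⊕ m) n K := fromRows 1 J with hZ
  set A : Matrix m (n ⊕ m) K := fromCols (-(B * J)) B with hA
  have hAZ : A * Z = 0 := by simp [hA, hZ, fromCols_mul_fromRows]
  have hZA : Zᵀ * Aᵀ = 0 := by rw [← transpose_mul, hAZ, transpose_zero]
  have hZv : ∀ u, Z *ᵥ u = Sum.elim u (J *ᵥ u) := fun u => by simp [hZ, fromRows_mulVec]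
  have hAt : ∀ w, Aᵀ *ᵥ w = Sum.elim (-(Jᵀ *ᵥ (Bᵀ *ᵥ w))) (Bᵀ *ᵥ w) := fun w => by
    simp [hA, transpose_fromCols, fromRows_mulVec, neg_mulVec]
  constructor
  · intro h u hu
    obtain ⟨q₁, q₂, hq⟩ : ∃ q₁ q₂, H *ᵥ (Z *ᵥ u) = Sum.elim q₁ q₂ :=
      ⟨_, _, (Sum.elim_comp_inl_inr _).symm⟩
    have hzero : q₁ + Jᵀ *ᵥ q₂ = 0 := by
      rw [← mulVec_mulVec, ← mulVec_mulVec, hq] at hu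
      simpa [hZ, transpose_fromRows, fromCols_mulVec] using hu
    obtain ⟨w, hw⟩ := (mulVec_surjective_iff_isUnit.2 hBt) (-q₂)
    have hv := h (Sum.elim (Z *ᵥ u) w) (by
      rw [fromBlocks_mulVec]
      simp only [Sum.elim_comp_inl, Sum.elim_comp_inr, hq, hAt, hw, mulVec_mulVec, hAZ,
        zero_mulVec, mulVec_neg, neg_neg, add_zero]
      rw [← Sum.elim_add_add, hzero]
      simp)
    funext i
    simpa [hZv] using congrFun hv (Sum.inl (Sum.inl i))
  · intro h v hv
    obtain ⟨u, t, w, rfl⟩ : ∃ u t w, v = Sum.elim (Sum.elim u t) w :=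
      ⟨(v ∘ Sum.inl) ∘ Sum.inl, (v ∘ Sum.inl) ∘ Sum.inr, v ∘ Sum.inr, by simp⟩
    rw [fromBlocks_mulVec] at hv
    simp only [Sum.elim_comp_inl, Sum.elim_comp_inr] at hv
    have h₁ : H *ᵥ Sum.elim u t + Aᵀ *ᵥ w = 0 := funext fun i => congrFun hv (Sum.inl i)
    have h₂ : A *ᵥ Sum.elim u t = 0 := by
      simpa using (funext fun i => congrFun hv (Sum.inr i) :
        A *ᵥ Sum.elim u t + (0 : Matrix m m K) *ᵥ w = 0)
    have ht : t = J *ᵥ u := by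
      refine sub_eq_zero.1 (hB' _ ?_)
      rw [mulVec_sub, mulVec_mulVec, sub_eq_neg_add, ← neg_mulVec]
      simpa [hA, fromCols_mulVec] using h₂
    have hu : u = 0 := h u (by
      rw [← mulVec_mulVec, ← mulVec_mulVec, hZv, ← ht, eq_neg_of_add_eq_zero_left h₁,
        mulVec_neg, mulVec_mulVec, hZA, zero_mulVec, neg_zero])
    subst hu
    have ht0 : t = 0 := by simpa using ht
    subst ht0
    have hw : w = 0 := hBt' w (by
      funext i
      simpa [hAt] using congrFun h₁ (Sum.inr i))
    subst hw
    simp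

/-- The symmetric KKT matrix [[∇²L, Aᵀ],[A, 0]] (with multipliers set to the
reverse-AD adjoints, at a feasible point) is invertible iff the Hessian of the
unconstrained objective is invertible. -/
theorem kkt_matrix_invertible_iff_objective_hessian_invertible
    (n m : ℕ)
    (g : (Fin n → ℝ) × (Fin m → ℝ) → ℝ)
    (Φ : (Fin n → ℝ) × (Fin m → ℝ) → (Fin m → ℝ))
    (S : (Fin n → ℝ) → (Fin m → ℝ))
    (f : (Fin n → ℝ) → ℝ)
    (L : (Fin n → ℝ) × (Fin m → ℝ) → ℝ)
    (x₀ : Fin n → ℝ) (s₀ : Fin m → ℝ) (lam₀ : Fin m → ℝ)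
    (Φx : Matrix (Fin m) (Fin n) ℝ) (Φs : Matrix (Fin m) (Fin m) ℝ)
    (HL : Matrix (Fin n ⊕ Fin m) (Fin n ⊕ Fin m) ℝ)
    (A : Matrix (Fin m) (Fin n ⊕ Fin m) ℝ)
    (Hf : Matrix (Fin n) (Fin n) ℝ)
    (hg : ContDiff ℝ 2 g) (hΦ : ContDiff ℝ 2 Φ)
    (hS : ContDiff ℝ 2 S)
    (hrec : ∀ x, S x = Φ (x, S x))
    (hf : ∀ x, f x = g (x, S x))
    (hs₀ : s₀ = S x₀)
    (hΦx : ∀ (u : Fin n → ℝ) (v : Fin m → ℝ),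
      fderiv ℝ Φ (x₀, s₀) (u, v) = Φx.mulVec u + Φs.mulVec v)
    (hIinv : IsUnit (1 - Φs))
    (hlam₀ : ∀ v : Fin m → ℝ,
      ((1 - Φs)ᵀ.mulVec lam₀) ⬝ᵥ v = fderiv ℝ g (x₀, s₀) (0, v))
    (hL : ∀ p : (Fin n → ℝ) × (Fin m → ℝ), L p = g p + lam₀ ⬝ᵥ (Φ p - p.2))
    (hHL : ∀ (u u' : Fin n → ℝ) (v v' : Fin m → ℝ),
      iteratedFDeriv ℝ 2 L (x₀, s₀) ![(u, v), (u', v')]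
        = (Sum.elim u v) ⬝ᵥ HL.mulVec (Sum.elim u' v'))
    (hA₁ : ∀ (i : Fin m) (j : Fin n), A i (Sum.inl j) = Φx i j)
    (hA₂ : ∀ (i j : Fin m), A i (Sum.inr j) = Φs i j - (1 : Matrix (Fin m) (Fin m) ℝ) i j)
    (hHf : ∀ u v : Fin n → ℝ,
      iteratedFDeriv ℝ 2 f x₀ ![u, v] = u ⬝ᵥ Hf.mulVec v) :
    IsUnit (Matrix.fromBlocks HL Aᵀ A (0 : Matrix (Fin m) (Fin m) ℝ)) ↔ IsUnit Hf := by
  subst hs₀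
  let ℓ : (Fin m → ℝ) →L[ℝ] ℝ := LinearMap.toContinuousLinearMap (dotProductBilin ℝ ℝ lam₀)
  have hℓ : ∀ v, ℓ v = lam₀ ⬝ᵥ v := fun v => rfl
  have hLfun : L = fun p => g p + ℓ (Φ p - p.2) := funext hL
  have hLC : ContDiff ℝ 2 L := by
    rw [hLfun]
    exact hg.add (ℓ.contDiff.comp (hΦ.sub contDiff_snd))
  have hΦd : Differentiable ℝ Φ := hΦ.differentiable (by norm_num)
  have hstat : ∀ w : Fin m → ℝ, fderiv ℝ L (x₀, S x₀) (0, w) = 0 := by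
    intro w
    have hd : HasFDerivAt (fun p => g p + ℓ (Φ p - p.2)) _ (x₀, S x₀) :=
      ((hg.differentiable (by norm_num)) (x₀, S x₀)).hasFDerivAt.add
        (ℓ.hasFDerivAt.comp (x₀, S x₀) ((hΦd (x₀, S x₀)).hasFDerivAt.sub hasFDerivAt_snd))
    rw [hLfun, hd.fderiv]
    simp only [_root_.add_apply, ContinuousLinearMap.comp_apply,
      _root_.sub_apply, ContinuousLinearMap.coe_snd', hΦx, hℓ, ← hlam₀ w,
      mulVec_transpose, ← dotProduct_mulVec, sub_mulVec, one_mulVec, mulVec_zero, zero_add]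
    rw [← dotProduct_add]
    simp
  have hfL : f = fun x => L (x, S x) := by
    funext x
    rw [hf, hL, ← hrec]
    simp
  let J : Matrix (Fin m) (Fin n) ℝ := LinearMap.toMatrix' (fderiv ℝ S x₀).toLinearMap
  have hJ : ∀ u, fderiv ℝ S x₀ u = J *ᵥ u := fun u =>
    (LinearMap.toMatrix'_mulVec (fderiv ℝ S x₀).toLinearMap u).symm
  have hJrec : ∀ u, J *ᵥ u = Φx *ᵥ u + Φs *ᵥ (J *ᵥ u) := by
    intro u
    have hSd : HasFDerivAt S (fderiv ℝ S x₀) x₀ :=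
      (hS.differentiable (by norm_num) x₀).hasFDerivAt
    have hcomp : HasFDerivAt (fun x => Φ (x, S x)) _ x₀ :=
      (hΦd (x₀, S x₀)).hasFDerivAt.comp x₀ ((hasFDerivAt_id x₀).prodMk hSd)
    rw [← (funext hrec : S = fun x => Φ (x, S x))] at hcomp
    have := congrArg (fun T => T u) (hSd.unique hcomp)
    simpa [hΦx, hJ] using this
  have hΦxJ : Φx = -((Φs - 1) * J) := by
    refine Matrix.ext_of_mulVec_single fun i => ?_
    have := hJrec (Pi.single i 1)
    rw [neg_mulVec, ← mulVec_mulVec, sub_mulVec, one_mulVec, neg_sub]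
    exact eq_sub_of_add_eq this.symm
  have hA : A = fromCols (-((Φs - 1) * J)) (Φs - 1) := by
    ext i (j | j)
    · rw [hA₁, hΦxJ, fromCols_apply_inl]
    · rw [hA₂, fromCols_apply_inr, Matrix.sub_apply]
  let Z : Matrix (Fin n ⊕ Fin m) (Fin n) ℝ := fromRows 1 J
  have hZ : ∀ u, Z *ᵥ u = Sum.elim u (J *ᵥ u) := fun u => by simp [Z, fromRows_mulVec]
  have hHf' : Hf = Zᵀ * HL * Z := by
    refine Matrix.ext_of_mulVec_single fun j => ?_
    refine dotProduct_eq _ _ fun u => ?_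
    rw [dotProduct_comm, ← hHf, hfL, iteratedFDeriv_two_comp_graph hLC hS hstat, hHL, hJ, hJ,
      ← hZ, ← hZ, dotProduct_comm _ u, ← mulVec_mulVec, ← mulVec_mulVec, dotProduct_mulVec u,
      vecMul_transpose]
  have hB : IsUnit (Φs - 1) := by
    rw [← neg_sub]
    exact hIinv.neg
  rw [hA, hHf']
  exact isUnit_saddlePoint_iff HL (Φs - 1) J hB
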